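/- Let A = (A_1,…,A_q) be a system of endomorphisms of V. The generalized Newton transformation of A satisfies the recurrence relations: T_0(A) = 1_V for the zero multi-index 0 = (0,…,0), and for every u ∈ ℕ^q with |u| ≥ 1, T_u(A) = σ_u(A)·1_V − Σ_{α=1}^q A_α ∘ T_{α♭(u)}(A) = σ_u(A)·1_V − Σ_{α=1}^q T_{α♭(u)}(A) ∘ A_α. -/

import Mathlib

open scoped BigOperators

namespace GNTPaper

variable {p q : ℕ}

/-- The Newton polynomial `P_A(t) = det(1_V + tA)` of a system of endomorphisms
(represented as matrices w.r.t. an orthonormal basis), as a multivariate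
polynomial in the variables `t_1, …, t_q`. -/
noncomputable def newtonMvPoly (A : Fin q → Matrix (Fin p) (Fin p) ℝ) :
    MvPolynomial (Fin q) ℝ :=
  Matrix.det (1 + ∑ α : Fin q, (MvPolynomial.X α : MvPolynomial (Fin q) ℝ) •
    (A α).map (fun x => (MvPolynomial.C x : MvPolynomial (Fin q) ℝ)))

/-- `σ_u(A)`: the coefficient of `t^u` in the Newton polynomial `P_A(t) = det(1 + tA)`. -/
noncomputable def sigma (A : Fin q → Matrix (Fin p) (Fin p) ℝ) (u : Fin q → ℕ) : ℝ :=
  MvPolynomial.coeff (Finsupp.equivFunOnFinite.symm u) (newtonMvPoly A)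

/-- A matrix `i ∈ I(q,s)` (a `q × s` matrix of zeros and ones with exactly one `1`
in each column) is encoded by the function `c : Fin s → Fin q` recording, for each
column `l`, the row `c l` containing its unique entry `1`.  `wt c α` is then the
weight `|i^α| = Σ_l i^α_l`, i.e. the number of columns whose `1` lies in row `α`. -/
def wt {s : ℕ} (c : Fin s → Fin q) (α : Fin q) : ℕ :=
  (Finset.univ.filter fun l => c l = α).card

/-- The ordered composition `A^i = A_{c(1)} ⬝ A_{c(2)} ⬝ ⋯ ⬝ A_{c(s)}` associated to a
matrix `i ∈ I(q,s)` encoded by `c : Fin s → Fin q` (`A^i = 1` for `s = 0`). -/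
noncomputable def prodSeq (A : Fin q → Matrix (Fin p) (Fin p) ℝ) {s : ℕ}
    (c : Fin s → Fin q) : Matrix (Fin p) (Fin p) ℝ :=
  (List.ofFn fun l => A (c l)).prod

/-- `σ_{u - |i|}(A)`, where by convention it is `0` whenever `u - |i|` has a
negative entry. -/
noncomputable def sigmaSub (A : Fin q → Matrix (Fin p) (Fin p) ℝ) (u : Fin q → ℕ)
    {s : ℕ} (c : Fin s → Fin q) : ℝ :=
  if ∀ α, wt c α ≤ u α then sigma A (fun α => u α - wt c α) else 0

/-- The generalized Newton transformation
`T_u(A) = Σ_{s=0}^{|u|} Σ_{i ∈ I(q,s)} (-1)^{‖i‖} σ_{u-|i|}(A) A^i`. -/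
noncomputable def gnt (A : Fin q → Matrix (Fin p) (Fin p) ℝ) (u : Fin q → ℕ) :
    Matrix (Fin p) (Fin p) ℝ :=
  ∑ s ∈ Finset.range ((∑ α, u α) + 1),
    (-1 : ℝ) ^ s • ∑ c : Fin s → Fin q, sigmaSub A u c • prodSeq A c

/-- `T_{α♭(u)}(A)`, with the convention that it is `0` when `u α = 0`. -/
noncomputable def gntFlat (A : Fin q → Matrix (Fin p) (Fin p) ℝ) (α : Fin q)
    (u : Fin q → ℕ) : Matrix (Fin p) (Fin p) ℝ :=
  if u α = 0 then 0 else gnt A (Function.update u α (u α - 1))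

/-- `σ_{α♭(u)}(A)`, with the convention that it is `0` when `u α = 0`. -/
noncomputable def sigmaFlat (A : Fin q → Matrix (Fin p) (Fin p) ℝ) (α : Fin q)
    (u : Fin q → ℕ) : ℝ :=
  if u α = 0 then 0 else sigma A (Function.update u α (u α - 1))

/-- The generalized Kronecker symbol `δ^{i_1…i_r}_{j_1…j_r}`, equal to `+1` (resp. `-1`)
if the `i`'s are distinct and the `j`'s are an even (resp. odd) permutation of the `i`'s,
and `0` otherwise; given by the classical determinant formula `det(δ_{i_k j_l})_{k,l}`. -/
noncomputable def gkron {n r : ℕ} (i j : Fin r → Fin n) : ℝ :=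
  Matrix.det (Matrix.of fun k l : Fin r => if i k = j l then (1 : ℝ) else 0)

/-- For `k < 2m`, the index `⌊k/2⌋ < m`; used to pair consecutive indices. -/
def halfIdx {m : ℕ} (k : Fin (2 * m)) : Fin m :=
  ⟨(k : ℕ) / 2, Nat.div_lt_of_lt_mul k.isLt⟩

/-- The scalar `S_r(A)` (for `r = 2m` even) from Reilly's construction. -/
noncomputable def Sr (A : Fin q → Matrix (Fin p) (Fin p) ℝ) (m : ℕ) : ℝ :=
  (1 / ((2 * m).factorial : ℝ)) *
    ∑ iv : Fin (2 * m) → Fin p, ∑ jv : Fin (2 * m) → Fin p,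
      gkron iv jv * ∑ a : Fin m → Fin q, ∏ k : Fin (2 * m), A (a (halfIdx k)) (iv k) (jv k)

/-- The Reilly operator `T_r(A)` (for `r = 2m` even). -/
noncomputable def TrReilly (A : Fin q → Matrix (Fin p) (Fin p) ℝ) (m : ℕ) :
    Matrix (Fin p) (Fin p) ℝ :=
  Matrix.of fun i j => (1 / ((2 * m).factorial : ℝ)) *
    ∑ iv : Fin (2 * m) → Fin p, ∑ jv : Fin (2 * m) → Fin p,
      gkron (Fin.snoc iv i) (Fin.snoc jv j) *
        ∑ a : Fin m → Fin q, ∏ k : Fin (2 * m), A (a (halfIdx k)) (iv k) (jv k)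

/-- The Reilly operator `T_{r+1}^α(A)` (for `r = 2m` even). -/
noncomputable def Tr1Reilly (A : Fin q → Matrix (Fin p) (Fin p) ℝ) (m : ℕ) (α : Fin q) :
    Matrix (Fin p) (Fin p) ℝ :=
  Matrix.of fun i j => (1 / ((2 * m).factorial : ℝ)) *
    ∑ iv : Fin (2 * m + 1) → Fin p, ∑ jv : Fin (2 * m + 1) → Fin p,
      gkron (Fin.snoc iv i) (Fin.snoc jv j) *
        (A α (iv (Fin.last (2 * m))) (jv (Fin.last (2 * m))) *
          ∑ a : Fin m → Fin q, ∏ k : Fin (2 * m),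
            A (a (halfIdx k)) (iv k.castSucc) (jv k.castSucc))

/-- The (finite) set of multi-indices `u ∈ 2ℕ(q)` with `|u| = r` (all entries even,
total length `r`). -/
noncomputable def evenIdx (q r : ℕ) : Finset (Fin q → ℕ) :=
  (Fintype.piFinset fun _ : Fin q => Finset.range (r + 1)).filter
    fun u => (∀ α, Even (u α)) ∧ ∑ α, u α = r

/-- Adjoining one occurrence of `α` to the index sequence lowers the multi-index by one at `α`. -/
theorem sigmaSub_of_wt_eq_add_single (A : Fin q → Matrix (Fin p) (Fin p) ℝ) (u : Fin q → ℕ)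
    (α : Fin q) {s t : ℕ} (c : Fin s → Fin q) (d : Fin t → Fin q)
    (h : ∀ β, wt d β = wt c β + if α = β then 1 else 0) :
    sigmaSub A u d =
      if u α = 0 then 0 else sigmaSub A (Function.update u α (u α - 1)) c := by
  by_cases hu : u α = 0
  · rw [if_pos hu, sigmaSub, if_neg]
    intro hle
    have := hle α
    rw [h α, if_pos rfl, hu] at this
    omega
  · rw [if_neg hu]
    have hle : (∀ β, wt d β ≤ u β) ↔ ∀ β, wt c β ≤ Function.update u α (u α - 1) β := by
      refine forall_congr' fun β => ?_
      rw [h β, Function.update_apply]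
      by_cases hβ : β = α
      · subst hβ
        simp only [if_true]
        omega
      · simp [hβ, Ne.symm hβ]
    have hsub : (fun β => u β - wt d β) =
        fun β => Function.update u α (u α - 1) β - wt c β := by
      funext β
      rw [h β, Function.update_apply]
      by_cases hβ : β = α
      · subst hβ
        simp only [if_true]
        omega
      · simp [hβ, Ne.symm hβ]
    simp only [sigmaSub, hle, hsub]

theorem wt_eq_sum {s : ℕ} (c : Fin s → Fin q) (β : Fin q) :
    wt c β = ∑ l, if c l = β then 1 else 0 :=
  Finset.card_filter _ _

theorem wt_cons {s : ℕ} (α : Fin q) (c : Fin s → Fin q) (β : Fin q) :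
    wt (Fin.cons α c : Fin (s + 1) → Fin q) β = wt c β + if α = β then 1 else 0 := by
  rw [wt_eq_sum, wt_eq_sum, Fin.sum_univ_succ, add_comm]
  simp only [Fin.cons_zero, Fin.cons_succ]

theorem wt_snoc {s : ℕ} (c : Fin s → Fin q) (α : Fin q) (β : Fin q) :
    wt (Fin.snoc c α : Fin (s + 1) → Fin q) β = wt c β + if α = β then 1 else 0 := by
  rw [wt_eq_sum, wt_eq_sum, Fin.sum_univ_castSucc]
  simp only [Fin.snoc_castSucc, Fin.snoc_last]

theorem prodSeq_cons (A : Fin q → Matrix (Fin p) (Fin p) ℝ) {s : ℕ} (α : Fin q)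
    (c : Fin s → Fin q) :
    prodSeq A (Fin.cons α c : Fin (s + 1) → Fin q) = A α * prodSeq A c := by
  simp [prodSeq, List.ofFn_succ]

theorem prodSeq_snoc (A : Fin q → Matrix (Fin p) (Fin p) ℝ) {s : ℕ} (c : Fin s → Fin q)
    (α : Fin q) :
    prodSeq A (Fin.snoc c α : Fin (s + 1) → Fin q) = prodSeq A c * A α := by
  rw [prodSeq, List.ofFn_succ_last]
  simp [prodSeq]

theorem sum_sigmaSub_smul_prodSeq_zero (A : Fin q → Matrix (Fin p) (Fin p) ℝ) (u : Fin q → ℕ) :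
    ∑ c : Fin 0 → Fin q, sigmaSub A u c • prodSeq A c = sigma A u • 1 := by
  simp [sigmaSub, prodSeq, wt]

theorem sigma_zero (A : Fin q → Matrix (Fin p) (Fin p) ℝ) : sigma A (fun _ => 0) = 1 := by
  have h0 : Finsupp.equivFunOnFinite.symm (fun _ : Fin q => 0) = 0 := by
    ext; rfl
  rw [sigma, h0, ← MvPolynomial.constantCoeff_eq, newtonMvPoly, RingHom.map_det]
  convert Matrix.det_one (n := Fin p) (R := ℝ)
  ext i j
  simp [Matrix.add_apply, Matrix.sum_apply, Matrix.one_apply, apply_ite]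

theorem sum_update_sub_one_add_one (u : Fin q → ℕ) (α : Fin q) (h : u α ≠ 0) :
    ∑ β, Function.update u α (u α - 1) β + 1 = ∑ β, u β := by
  rw [Finset.sum_update_of_mem (Finset.mem_univ α),
    Finset.sum_eq_add_sum_sdiff_singleton_of_mem (Finset.mem_univ α) u]
  omega

/-- `T_{α♭(u)}(A)` as a sum over lengths `s < |u|`. -/
theorem gntFlat_eq_sum (A : Fin q → Matrix (Fin p) (Fin p) ℝ) (α : Fin q) (u : Fin q → ℕ) :
    gntFlat A α u = ∑ s ∈ Finset.range (∑ β, u β), (-1 : ℝ) ^ s • ∑ c : Fin s → Fin q,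
      (if u α = 0 then 0 else sigmaSub A (Function.update u α (u α - 1)) c) • prodSeq A c := by
  by_cases h : u α = 0
  · simp [gntFlat, h]
  · simp only [gntFlat, h, if_false, gnt, sum_update_sub_one_add_one u α h]

/-- Splitting off the term of length `0`. -/
theorem gnt_eq_sub_sum (A : Fin q → Matrix (Fin p) (Fin p) ℝ) (u : Fin q → ℕ) :
    gnt A u = sigma A u • 1 - ∑ s ∈ Finset.range (∑ β, u β), (-1 : ℝ) ^ s •
      ∑ d : Fin (s + 1) → Fin q, sigmaSub A u d • prodSeq A d := by
  rw [gnt, Finset.sum_range_succ', sum_sigmaSub_smul_prodSeq_zero]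
  simp [pow_succ, Finset.sum_neg_distrib, sub_eq_add_neg, add_comm]

theorem gnt_eq_sub_sum_mul_gntFlat (A : Fin q → Matrix (Fin p) (Fin p) ℝ) (u : Fin q → ℕ) :
    gnt A u = sigma A u • 1 - ∑ α, A α * gntFlat A α u := by
  simp only [gnt_eq_sub_sum, gntFlat_eq_sum, Finset.mul_sum, mul_smul_comm]
  rw [Finset.sum_comm]
  congr 1
  refine Finset.sum_congr rfl fun s _ => ?_
  rw [← Finset.smul_sum, ← Fintype.sum_prod_type', ← (Fin.consEquiv fun _ => Fin q).sum_comp]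
  congr 1
  refine Finset.sum_congr rfl fun x _ => ?_
  simp only [Fin.consEquiv, Equiv.coe_fn_mk]
  rw [sigmaSub_of_wt_eq_add_single A u x.1 x.2 _ (wt_cons x.1 x.2), prodSeq_cons]

theorem gnt_eq_sub_sum_gntFlat_mul (A : Fin q → Matrix (Fin p) (Fin p) ℝ) (u : Fin q → ℕ) :
    gnt A u = sigma A u • 1 - ∑ α, gntFlat A α u * A α := by
  simp only [gnt_eq_sub_sum, gntFlat_eq_sum, Finset.sum_mul, smul_mul_assoc]
  rw [Finset.sum_comm]
  congr 1
  refine Finset.sum_congr rfl fun s _ => ?_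
  rw [← Finset.smul_sum, ← Fintype.sum_prod_type', ← (Fin.snocEquiv fun _ => Fin q).sum_comp]
  congr 1
  refine Finset.sum_congr rfl fun x _ => ?_
  simp only [Fin.snocEquiv, Equiv.coe_fn_mk]
  rw [sigmaSub_of_wt_eq_add_single A u x.1 x.2 _ (wt_snoc x.2 x.1), prodSeq_snoc]

theorem statement_5 (hq : 1 ≤ q) (A : Fin q → Matrix (Fin p) (Fin p) ℝ) :
    gnt A (fun _ => 0) = 1 ∧
    ∀ u : Fin q → ℕ, 1 ≤ ∑ α, u α →
      gnt A u = sigma A u • (1 : Matrix (Fin p) (Fin p) ℝ) - ∑ α, A α * gntFlat A α u ∧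
      gnt A u = sigma A u • (1 : Matrix (Fin p) (Fin p) ℝ) - ∑ α, gntFlat A α u * A α := by
  refine ⟨?_, fun u _ => ⟨gnt_eq_sub_sum_mul_gntFlat A u, gnt_eq_sub_sum_gntFlat_mul A u⟩⟩
  simp [gnt_eq_sub_sum, sigma_zero]

end GNTPaper
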